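/- (Liouville-type classification.) Let n ≥ 3 be an integer and γ < (n−2)²/4. Let u ∈ C²(ℝⁿ\{0}) be nonnegative and satisfy Δu(x) + γ |x|^{−2} u(x) = 0 for all x ∈ ℝⁿ\{0}. Then there exist constants C₋ ≥ 0 and C₊ ≥ 0 such that u(x) = C₋ |x|^{−β₋(γ)} + C₊ |x|^{−β₊(γ)} for all x ∈ ℝⁿ\{0}. -/

import Mathlib

open Real Filter Set

/-- The Euclidean Laplacian of `u : ℝⁿ → ℝ` at `x`, as the trace of the second derivative. -/
noncomputable def lap (n : ℕ) (u : EuclideanSpace ℝ (Fin n) → ℝ)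
    (x : EuclideanSpace ℝ (Fin n)) : ℝ :=
  ∑ i : Fin n,
    fderiv ℝ (fun y => fderiv ℝ u y (EuclideanSpace.single i 1)) x (EuclideanSpace.single i 1)

open MeasureTheory Topology

section Integration

variable {n : ℕ}

theorem ae_ne_zero [NeZero n] : ∀ᵐ x : EuclideanSpace ℝ (Fin n), x ≠ 0 := by
  simp [ae_iff]

theorem integrable_of_continuousOn_compl_zero [NeZero n] {f : EuclideanSpace ℝ (Fin n) → ℝ}
    {K : Set (EuclideanSpace ℝ (Fin n))} (hf : ContinuousOn f {0}ᶜ) (hK : IsCompact K)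
    (hK0 : K ⊆ {0}ᶜ) (hfK : ∀ x ≠ 0, x ∉ K → f x = 0) : Integrable f := by
  refine ((hf.mono hK0).integrableOn_compact hK).integrable_of_ae_notMem_eq_zero ?_
  filter_upwards [ae_ne_zero] with x hx hxK using hfK x hx hxK

/-- Green's identity for a function that is `C²` off the origin and a `C²` test function whose
support avoids the origin. -/
theorem integral_mul_lap_eq [NeZero n] {u Φ : EuclideanSpace ℝ (Fin n) → ℝ}
    (hu : ContDiffOn ℝ 2 u {0}ᶜ) (hΦ : ContDiffOn ℝ 2 Φ {0}ᶜ) (hc : HasCompactSupport Φ)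
    (h0 : tsupport Φ ⊆ {0}ᶜ) :
    ∫ x, u x * lap n Φ x = ∫ x, lap n u x * Φ x := by
  have ho : IsOpen ({0}ᶜ : Set (EuclideanSpace ℝ (Fin n))) := isOpen_compl_singleton
  have hd1 : ∀ {f : EuclideanSpace ℝ (Fin n) → ℝ}, ContDiffOn ℝ 2 f {0}ᶜ → ∀ v,
      ContDiffOn ℝ 1 (fun y => fderiv ℝ f y v) {0}ᶜ := fun hf v =>
    (hf.fderiv_of_isOpen ho (by norm_num)).clm_apply contDiffOn_const
  have hd2 : ∀ {f : EuclideanSpace ℝ (Fin n) → ℝ}, ContDiffOn ℝ 1 f {0}ᶜ → ∀ v,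
      ContinuousOn (fun y => fderiv ℝ f y v) {0}ᶜ := fun hf v =>
    ((hf.fderiv_of_isOpen (m := 0) ho (by norm_num)).clm_apply contDiffOn_const).continuousOn
  have hda : ∀ {f : EuclideanSpace ℝ (Fin n) → ℝ}, ContDiffOn ℝ 1 f {0}ᶜ → ∀ x ≠ 0,
      DifferentiableAt ℝ f x := fun hf x hx =>
    (hf.differentiableOn (by norm_num)).differentiableAt (ho.mem_nhds hx)
  have hu1 : ContDiffOn ℝ 1 u {0}ᶜ := hu.of_le (by norm_num)
  have hΦ1 : ContDiffOn ℝ 1 Φ {0}ᶜ := hΦ.of_le (by norm_num)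
  have hts : ∀ (f : EuclideanSpace ℝ (Fin n) → ℝ) (v),
      tsupport (fun y => fderiv ℝ f y v) ⊆ tsupport f := fun f v => tsupport_fderiv_apply_subset ℝ v
  have hint : ∀ {f g : EuclideanSpace ℝ (Fin n) → ℝ}, ContinuousOn f {0}ᶜ → ContinuousOn g {0}ᶜ →
      tsupport g ⊆ tsupport Φ → Integrable (fun x => f x * g x) := fun {f g} hf hg hs =>
    integrable_of_continuousOn_compl_zero (hf.mul hg) hc h0 fun x _ hx => by
      rw [image_eq_zero_of_notMem_tsupport (fun h => hx (hs h)), mul_zero]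
  let e : Fin n → EuclideanSpace ℝ (Fin n) := fun i => EuclideanSpace.single i 1
  have hI1 : ∀ i, Integrable (fun x => u x * fderiv ℝ (fun y => fderiv ℝ Φ y (e i)) x (e i)) :=
    fun i => hint hu.continuousOn (hd2 (hd1 hΦ _) _) ((hts _ _).trans (hts _ _))
  have hI2 : ∀ i, Integrable (fun x => fderiv ℝ (fun y => fderiv ℝ u y (e i)) x (e i) * Φ x) :=
    fun i => hint (hd2 (hd1 hu _) _) hΦ.continuousOn le_rfl
  have hI3 : ∀ i, Integrable (fun x => fderiv ℝ u x (e i) * fderiv ℝ Φ x (e i)) :=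
    fun i => hint (hd2 hu1 _) (hd2 hΦ1 _) (hts _ _)
  have key : ∀ i, ∫ x, u x * fderiv ℝ (fun y => fderiv ℝ Φ y (e i)) x (e i) =
      ∫ x, fderiv ℝ (fun y => fderiv ℝ u y (e i)) x (e i) * Φ x := by
    intro i
    have h1 := integral_mul_fderiv_eq_neg_fderiv_mul_of_integrable (μ := volume)
      (f := u) (g := fun y => fderiv ℝ Φ y (e i)) (v := e i)
      (hI3 i) (hI1 i) (hint hu.continuousOn (hd2 hΦ1 _) (hts _ _))
      (fun x hx => hda hu1 x (h0 (hts _ _ hx)))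
      (fun x hx => by
        by_cases hx0 : x = 0
        · have : (fun y => fderiv ℝ Φ y (e i)) =ᶠ[𝓝 x] 0 :=
            notMem_tsupport_iff_eventuallyEq.mp fun h => h0 (hts _ _ h) hx0
          exact (this.differentiableAt_iff).2 (differentiableAt_const 0)
        · exact hda (hd1 hΦ _) x hx0)
    have h2 := integral_mul_fderiv_eq_neg_fderiv_mul_of_integrable (μ := volume)
      (f := fun y => fderiv ℝ u y (e i)) (g := Φ) (v := e i)
      (hI2 i) (hI3 i) (hint (hd2 hu1 _) hΦ.continuousOn le_rfl)
      (fun x hx => hda (hd1 hu _) x (h0 hx))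
      (fun x hx => by
        by_cases hx0 : x = 0
        · have : Φ =ᶠ[𝓝 x] 0 := notMem_tsupport_iff_eventuallyEq.mp fun h => h0 h hx0
          exact (this.differentiableAt_iff).2 (differentiableAt_const 0)
        · exact hda hΦ1 x hx0)
    rw [h1, h2, neg_neg]
  simp only [lap, Finset.mul_sum, Finset.sum_mul]
  rw [integral_finsetSum _ fun i _ => hI1 i, integral_finsetSum _ fun i _ => hI2 i]
  exact Finset.sum_congr rfl fun i _ => key i

end Integration

section ExponentialSolutions

theorem exists_eq_exp_add_exp {q q' : ℝ → ℝ} {κ : ℝ} (hκ : 0 < κ)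
    (hq : ∀ t, HasDerivAt q (q' t) t) (hq' : ∀ t, HasDerivAt q' (κ ^ 2 * q t) t) :
    ∃ A B : ℝ, ∀ t, q t = A * exp (κ * t) + B * exp (-(κ * t)) := by
  have hexp : ∀ c t : ℝ, HasDerivAt (fun t => exp (c * t)) (exp (c * t) * c) t := fun c t => by
    simpa using ((hasDerivAt_id t).const_mul c).exp
  have h1 : ∀ t, HasDerivAt (fun t => (q' t - κ * q t) * exp (κ * t)) 0 t := fun t => by
    exact (((hq' t).fun_sub ((hq t).const_mul κ)).fun_mul (hexp κ t)).congr_deriv (by ring)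
  have h2 : ∀ t, HasDerivAt (fun t => (q' t + κ * q t) * exp (-κ * t)) 0 t := fun t => by
    exact (((hq' t).fun_add ((hq t).const_mul κ)).fun_mul (hexp (-κ) t)).congr_deriv (by ring)
  have c1 := fun t => is_const_of_deriv_eq_zero (fun t => (h1 t).differentiableAt)
    (fun t => (h1 t).deriv) t 0
  have c2 := fun t => is_const_of_deriv_eq_zero (fun t => (h2 t).differentiableAt)
    (fun t => (h2 t).deriv) t 0
  refine ⟨(q' 0 + κ * q 0) / (2 * κ), -(q' 0 - κ * q 0) / (2 * κ), fun t => ?_⟩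
  have e1 := c1 t
  have e2 := c2 t
  simp only [neg_mul, mul_zero, exp_zero, mul_one] at e1 e2
  rw [← e1, ← e2]
  have : exp (κ * t) * exp (-(κ * t)) = 1 := by rw [← exp_add]; simp
  field_simp
  linear_combination (-2 * κ * q t) * this

theorem tendsto_exp_mul_atTop_zero {c : ℝ} (hc : c < 0) :
    Tendsto (fun t => exp (c * t)) atTop (𝓝 0) :=
  tendsto_exp_atBot.comp (tendsto_id.const_mul_atTop_of_neg hc)

theorem tendsto_exp_add_exp_mul {κ : ℝ} (hκ : 0 < κ) (A B : ℝ) :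
    Tendsto (fun t => (A * exp (κ * t) + B * exp (-(κ * t))) * exp (-(κ * t))) atTop (𝓝 A) := by
  have h := ((tendsto_exp_mul_atTop_zero (c := -2 * κ) (by linarith)).const_mul B).const_add A
  rw [mul_zero, add_zero] at h
  refine h.congr fun t => ?_
  have e1 : exp (κ * t) * exp (-(κ * t)) = 1 := by rw [← exp_add]; simp
  have e2 : exp (-(κ * t)) * exp (-(κ * t)) = exp (-2 * κ * t) := by rw [← exp_add]; ring_nf
  linear_combination (-A) * e1 - B * e2

theorem coeff_nonneg_of_exp_add_exp_nonneg {κ A B : ℝ} (hκ : 0 < κ)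
    (h : ∀ t, 0 ≤ A * exp (κ * t) + B * exp (-(κ * t))) : 0 ≤ A ∧ 0 ≤ B := by
  constructor
  · exact ge_of_tendsto' (tendsto_exp_add_exp_mul hκ A B) fun t => mul_nonneg (h t) (exp_pos _).le
  · refine ge_of_tendsto' (tendsto_exp_add_exp_mul hκ B A) fun t => mul_nonneg ?_ (exp_pos _).le
    have := h (-t)
    simp only [mul_neg, neg_neg] at this
    linarith

theorem coeff_eq_zero_of_abs_le {κ l A B A' B' : ℝ} (hl : 0 ≤ l) (hlκ : l < κ)
    (h : ∀ t, |A * exp (κ * t) + B * exp (-(κ * t))| ≤ A' * exp (l * t) + B' * exp (-(l * t))) :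
    A = 0 ∧ B = 0 := by
  have aux : ∀ A B A' B' : ℝ,
      (∀ t, |A * exp (κ * t) + B * exp (-(κ * t))| ≤ A' * exp (l * t) + B' * exp (-(l * t))) →
      A = 0 := by
    intro A B A' B' h
    have h1 := ((tendsto_exp_mul_atTop_zero (c := l - κ) (by linarith)).const_mul A').add
      ((tendsto_exp_mul_atTop_zero (c := -l - κ) (by linarith)).const_mul B')
    simp only [mul_zero, add_zero] at h1
    refine tendsto_nhds_unique (tendsto_exp_add_exp_mul (hl.trans_lt hlκ) A B)
      (squeeze_zero_norm (fun t => ?_) h1)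
    rw [norm_mul, Real.norm_eq_abs, Real.norm_eq_abs, abs_exp]
    calc _ ≤ (A' * exp (l * t) + B' * exp (-(l * t))) * exp (-(κ * t)) :=
          mul_le_mul_of_nonneg_right (h t) (exp_pos _).le
      _ = _ := by
          rw [add_mul, mul_assoc, mul_assoc, ← exp_add, ← exp_add]
          ring_nf
  refine ⟨aux A B A' B' h, aux B A B' A' fun t => ?_⟩
  have := h (-t)
  simp only [mul_neg, neg_neg] at this
  rw [add_comm, add_comm (B' * _)]
  exact this

end ExponentialSolutions

section PolynomialTimesRadial

open MvPolynomial

variable {n : ℕ}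

theorem hasFDerivAt_eval (p : MvPolynomial (Fin n) ℝ) (x : EuclideanSpace ℝ (Fin n)) :
    HasFDerivAt (fun y : EuclideanSpace ℝ (Fin n) => eval y.ofLp p)
      (∑ i, eval x.ofLp (pderiv i p) • EuclideanSpace.proj (𝕜 := ℝ) i) x := by
  induction p using MvPolynomial.induction_on with
  | C a => simpa using hasFDerivAt_const a x
  | add p q hp hq =>
    simp only [map_add, add_smul, Finset.sum_add_distrib]
    exact hp.add hq
  | mul_X p i hp =>
    simp only [map_mul, eval_X]
    have := hp.mul ((EuclideanSpace.proj (𝕜 := ℝ) (ι := Fin n) i : _ →L[ℝ] ℝ).hasFDerivAt (x := x))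
    refine this.congr_fderiv ?_
    ext v
    simp [pderiv_X, Finset.mul_sum, mul_add, Finset.sum_add_distrib, Pi.single_apply,
      apply_ite (eval x.ofLp), mul_comm, mul_left_comm]

theorem contDiff_eval (p : MvPolynomial (Fin n) ℝ) {m : WithTop ℕ∞} :
    ContDiff ℝ m (fun y : EuclideanSpace ℝ (Fin n) => eval y.ofLp p) := by
  induction p using MvPolynomial.induction_on with
  | C a => simpa using contDiff_const
  | add p q hp hq => simpa using hp.add hq
  | mul_X p i hp =>
    simpa using hp.mul (EuclideanSpace.proj (𝕜 := ℝ) (ι := Fin n) i : _ →L[ℝ] ℝ).contDiff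

theorem fderiv_eval_mul_radial (p : MvPolynomial (Fin n) ℝ) {g : ℝ → ℝ} {g' : ℝ}
    {x : EuclideanSpace ℝ (Fin n)} (hg : HasDerivAt g g' (‖x‖ ^ 2)) (i : Fin n) :
    DifferentiableAt ℝ (fun y : EuclideanSpace ℝ (Fin n) => eval y.ofLp p * g (‖y‖ ^ 2)) x ∧
    fderiv ℝ (fun y : EuclideanSpace ℝ (Fin n) => eval y.ofLp p * g (‖y‖ ^ 2)) x
      (EuclideanSpace.single i 1) =
      eval x.ofLp (pderiv i p) * g (‖x‖ ^ 2) + eval x.ofLp p * (2 * x i) * g' := by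
  have hn : HasFDerivAt (fun y : EuclideanSpace ℝ (Fin n) => ‖y‖ ^ 2) _ x :=
    (hasStrictFDerivAt_norm_sq x).hasFDerivAt
  have h := (hasFDerivAt_eval p x).mul (hg.comp_hasFDerivAt x hn)
  refine ⟨h.differentiableAt, ?_⟩
  erw [h.fderiv]
  simp [EuclideanSpace.inner_single_right]
  ring

/-- The Laplacian of a polynomial times a radial function. -/
theorem lap_eval_mul_radial {d : ℕ} {p : MvPolynomial (Fin n) ℝ} (hp : p.IsHomogeneous d)
    {g g₁ g₂ : ℝ → ℝ} (hg : ∀ q > 0, HasDerivAt g (g₁ q) q)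
    (hg₁ : ∀ q > 0, HasDerivAt g₁ (g₂ q) q) {x : EuclideanSpace ℝ (Fin n)} (hx : x ≠ 0) :
    lap n (fun y => eval y.ofLp p * g (‖y‖ ^ 2)) x =
      eval x.ofLp (∑ i, pderiv i (pderiv i p)) * g (‖x‖ ^ 2) +
      eval x.ofLp p *
        (4 * ‖x‖ ^ 2 * g₂ (‖x‖ ^ 2) + (4 * d + 2 * n) * g₁ (‖x‖ ^ 2)) := by
  have hpos : ∀ {y : EuclideanSpace ℝ (Fin n)}, y ≠ 0 → 0 < ‖y‖ ^ 2 := fun hy =>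
    pow_pos (norm_pos_iff.2 hy) 2
  have hterm : ∀ i : Fin n,
      fderiv ℝ (fun y => fderiv ℝ (fun y : EuclideanSpace ℝ (Fin n) => eval y.ofLp p * g (‖y‖ ^ 2))
        y (EuclideanSpace.single i 1)) x (EuclideanSpace.single i 1) =
      eval x.ofLp (pderiv i (pderiv i p)) * g (‖x‖ ^ 2) +
        4 * g₁ (‖x‖ ^ 2) * (x i * eval x.ofLp (pderiv i p)) + 2 * eval x.ofLp p * g₁ (‖x‖ ^ 2)
        + 4 * eval x.ofLp p * g₂ (‖x‖ ^ 2) * (x i) ^ 2 := by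
    intro i
    have hev : (fun y => fderiv ℝ (fun y : EuclideanSpace ℝ (Fin n) => eval y.ofLp p * g (‖y‖ ^ 2))
        y (EuclideanSpace.single i 1)) =ᶠ[𝓝 x] ((fun y => eval y.ofLp (pderiv i p) * g (‖y‖ ^ 2)) +
          fun y => eval y.ofLp (p * X i) * (fun q => 2 * g₁ q) (‖y‖ ^ 2)) := by
      filter_upwards [isOpen_compl_singleton.mem_nhds hx] with y hy
      rw [(fderiv_eval_mul_radial p (hg _ (hpos hy)) i).2]
      simp; ring
    have h1 := fderiv_eval_mul_radial (pderiv i p) (hg _ (hpos hx)) i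
    have h2 := fderiv_eval_mul_radial (p * X i) ((hg₁ _ (hpos hx)).const_mul 2) i
    rw [hev.fderiv_eq, fderiv_add h1.1 h2.1, add_apply, h1.2, h2.2]
    simp [pderiv_X]
    ring
  have heuler : ∑ i, x i * eval x.ofLp (pderiv i p) = d * eval x.ofLp p := by
    have := congrArg (eval x.ofLp) hp.sum_X_mul_pderiv
    simpa using this
  have hsq : ∑ i, x i ^ 2 = ‖x‖ ^ 2 := by simp [EuclideanSpace.norm_sq_eq]
  rw [lap, Finset.sum_congr rfl fun i _ => hterm i]
  simp only [Finset.sum_add_distrib, ← Finset.mul_sum, heuler, hsq, map_sum, Finset.sum_mul,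
    Finset.sum_const, Finset.card_univ, Fintype.card_fin, nsmul_eq_mul]
  ring

end PolynomialTimesRadial

section LogarithmicTranslates

variable {n : ℕ}

theorem isCompact_annulus (b : ℝ) :
    IsCompact {x : EuclideanSpace ℝ (Fin n) | exp (-b) ≤ ‖x‖ ∧ ‖x‖ ≤ exp b} := by
  refine (isCompact_closedBall (0 : EuclideanSpace ℝ (Fin n)) (exp b)).of_isClosed_subset ?_ ?_
  · exact (isClosed_le continuous_const continuous_norm).inter
      (isClosed_le continuous_norm continuous_const)
  · intro x hx
    simpa using hx.2

theorem annulus_subset (b : ℝ) :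
    {x : EuclideanSpace ℝ (Fin n) | exp (-b) ≤ ‖x‖ ∧ ‖x‖ ≤ exp b} ⊆ {0}ᶜ := by
  rintro x ⟨hx, -⟩ rfl
  exact absurd hx (by simpa using exp_pos (-b))

theorem mem_annulus_of_abs_log_le {b : ℝ} {x : EuclideanSpace ℝ (Fin n)} (hx : x ≠ 0)
    (h : |Real.log ‖x‖| ≤ b) : exp (-b) ≤ ‖x‖ ∧ ‖x‖ ≤ exp b := by
  have hx' := norm_pos_iff.2 hx
  rw [abs_le] at h
  exact ⟨(le_log_iff_exp_le hx').1 h.1, (log_le_iff_le_exp hx').1 h.2⟩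

theorem continuousOn_log_norm :
    ContinuousOn (fun x : EuclideanSpace ℝ (Fin n) => Real.log ‖x‖) {0}ᶜ :=
  continuous_norm.continuousOn.log fun _ hx => norm_ne_zero_iff.2 hx

theorem exists_forall_eq_zero_of_hasCompactSupport {φ : ℝ → ℝ} (hc : HasCompactSupport φ) :
    ∃ M : ℝ, ∀ t, M < |t| → φ t = 0 := by
  obtain ⟨M, hM⟩ := hc.isCompact.isBounded.subset_closedBall 0
  refine ⟨M, fun t ht => image_eq_zero_of_notMem_tsupport fun h => ?_⟩
  have := hM h
  simp at this
  linarith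

theorem exists_annulus_of_hasCompactSupport {φ : ℝ → ℝ} (hc : HasCompactSupport φ) (r : ℝ) :
    ∃ b : ℝ, ∀ s, |s| ≤ r → ∀ x : EuclideanSpace ℝ (Fin n), x ≠ 0 →
      x ∉ {x : EuclideanSpace ℝ (Fin n) | exp (-b) ≤ ‖x‖ ∧ ‖x‖ ≤ exp b} →
      φ (Real.log ‖x‖ - s) = 0 := by
  obtain ⟨M, hM⟩ := exists_forall_eq_zero_of_hasCompactSupport hc
  refine ⟨M + r, fun s hs x hx hxK => hM _ ?_⟩
  by_contra! h
  refine hxK (mem_annulus_of_abs_log_le hx ?_)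
  have := abs_sub_abs_le_abs_sub (Real.log ‖x‖) s
  linarith

variable [NeZero n]

theorem integrable_mul_log_norm {F : EuclideanSpace ℝ (Fin n) → ℝ} (hF : ContinuousOn F {0}ᶜ)
    {φ : ℝ → ℝ} (hφ : Continuous φ) (hc : HasCompactSupport φ) (s : ℝ) :
    Integrable (fun x => F x * φ (Real.log ‖x‖ - s)) := by
  obtain ⟨b, hb⟩ := exists_annulus_of_hasCompactSupport (n := n) hc |s|
  refine integrable_of_continuousOn_compl_zero ?_ (isCompact_annulus b) (annulus_subset b)
    fun x hx hxK => by rw [hb s le_rfl x hx hxK, mul_zero]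
  exact hF.mul (hφ.comp_continuousOn (continuousOn_log_norm.sub continuousOn_const))

theorem hasDerivAt_integral_mul_log_norm {F : EuclideanSpace ℝ (Fin n) → ℝ}
    (hF : ContinuousOn F {0}ᶜ) {φ φ' : ℝ → ℝ} (hφ : ∀ t, HasDerivAt φ (φ' t) t)
    (hφ' : Continuous φ') (hc : HasCompactSupport φ) (hc' : HasCompactSupport φ') (s : ℝ) :
    HasDerivAt (fun s => ∫ x, F x * φ (Real.log ‖x‖ - s))
      (-∫ x, F x * φ' (Real.log ‖x‖ - s)) s := by
  have hφc : Continuous φ := continuous_iff_continuousAt.2 fun t => (hφ t).continuousAt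
  obtain ⟨b, hb⟩ := exists_annulus_of_hasCompactSupport (n := n) hc' (|s| + 1)
  obtain ⟨C, hC⟩ := hc'.exists_bound_of_continuous hφ'
  set K := {x : EuclideanSpace ℝ (Fin n) | exp (-b) ≤ ‖x‖ ∧ ‖x‖ ≤ exp b}
  have hbound : Integrable (K.indicator fun x => ‖F x‖ * C) := by
    rw [integrable_indicator_iff (isCompact_annulus b).measurableSet]
    exact (((hF.mono (annulus_subset b)).norm).mul continuousOn_const).integrableOn_compact
      (isCompact_annulus b)
  rw [← integral_neg]
  refine (hasDerivAt_integral_of_dominated_loc_of_deriv_le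
    (F := fun s x => F x * φ (Real.log ‖x‖ - s))
    (F' := fun s x => -(F x * φ' (Real.log ‖x‖ - s)))
    (Metric.ball_mem_nhds s one_pos)
    (Eventually.of_forall fun s => (integrable_mul_log_norm hF hφc hc s).aestronglyMeasurable)
    (integrable_mul_log_norm hF hφc hc s)
    (integrable_mul_log_norm hF hφ' hc' s).neg.aestronglyMeasurable ?_ hbound ?_).2
  · filter_upwards [ae_ne_zero] with x hx t ht
    by_cases hxK : x ∈ K
    · rw [Set.indicator_of_mem hxK, norm_neg, norm_mul]
      exact mul_le_mul_of_nonneg_left (hC _) (norm_nonneg _)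
    · rw [Set.indicator_of_notMem hxK, hb t ?_ x hx hxK]
      · simp
      · rw [Metric.mem_ball, Real.dist_eq] at ht
        have := abs_sub_abs_le_abs_sub t s
        linarith
  · refine Eventually.of_forall fun x t _ => ?_
    have h := ((hφ (Real.log ‖x‖ - t)).comp t ((hasDerivAt_id t).const_sub (Real.log ‖x‖))).const_mul
      (F x)
    exact h.congr_deriv (by ring)

end LogarithmicTranslates

section Moments

open MvPolynomial

variable {n : ℕ}

/-- A nonnegative `C²` solution of `Δu + γ|x|⁻²u = 0` on the punctured space. -/
structure IsHardySolution (n : ℕ) (γ : ℝ) (u : EuclideanSpace ℝ (Fin n) → ℝ) : Prop where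
  contDiffOn : ContDiffOn ℝ 2 u {0}ᶜ
  nonneg : ∀ x ≠ 0, 0 ≤ u x
  eq_zero : ∀ x ≠ 0, lap n u x + γ * ‖x‖ ^ (-(2 : ℝ)) * u x = 0

/-- The moment of `u` against a polynomial `p`, thought of as homogeneous of degree `d`, localised
by the profile `φ` in the variable `log |x| - s`, with the weight for which the moments of a
solution of the Hardy equation satisfy an equation with constant coefficients. -/
noncomputable def moment (u : EuclideanSpace ℝ (Fin n) → ℝ) (d : ℝ) (p : MvPolynomial (Fin n) ℝ)
    (φ : ℝ → ℝ) (s : ℝ) : ℝ :=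
  ∫ x, (u x * eval x.ofLp p * ‖x‖ ^ (-((n + 2) / 2) - d : ℝ)) * φ (Real.log ‖x‖ - s)

theorem lap_eval_mul_rpow_mul_log {d : ℕ} {p : MvPolynomial (Fin n) ℝ} (hp : p.IsHomogeneous d)
    {φ φ₁ φ₂ : ℝ → ℝ} (hφ : ∀ t, HasDerivAt φ (φ₁ t) t) (hφ₁ : ∀ t, HasDerivAt φ₁ (φ₂ t) t)
    (s : ℝ) {x : EuclideanSpace ℝ (Fin n)} (hx : x ≠ 0) :
    lap n (fun y => eval y.ofLp p *
        (‖y‖ ^ (-((n + 2) / 2) - (d - 2) : ℝ) * φ (Real.log ‖y‖ - s))) x =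
      eval x.ofLp (∑ i, pderiv i (pderiv i p)) * ‖x‖ ^ (-((n + 2) / 2) - (d - 2) : ℝ) *
        φ (Real.log ‖x‖ - s) +
      eval x.ofLp p * ‖x‖ ^ (-((n + 2) / 2) - d : ℝ) *
        (φ₂ (Real.log ‖x‖ - s) - ((n - 2) / 2 + d) ^ 2 * φ (Real.log ‖x‖ - s)) := by
  set α : ℝ := -(n - 2) / 4 - d / 2 with hα
  have hlog : ∀ q > 0, HasDerivAt (fun q => Real.log q / 2 - s) (1 / 2 * q⁻¹) q := fun q hq =>
    (((Real.hasDerivAt_log hq.ne').div_const 2).sub_const s).congr_deriv (by ring)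
  have hg : ∀ q > 0, HasDerivAt (fun q => q ^ α * φ (Real.log q / 2 - s))
      (q ^ (α - 1) * (α * φ (Real.log q / 2 - s) + 1 / 2 * φ₁ (Real.log q / 2 - s))) q := by
    intro q hq
    refine ((Real.hasDerivAt_rpow_const (p := α) (Or.inl hq.ne')).fun_mul
      ((hφ _).comp q (hlog q hq))).congr_deriv ?_
    simp only [Function.comp_apply]
    rw [Real.rpow_sub_one hq.ne']
    ring
  have hg₁ : ∀ q > 0, HasDerivAt
      (fun q => q ^ (α - 1) * (α * φ (Real.log q / 2 - s) + 1 / 2 * φ₁ (Real.log q / 2 - s)))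
      (q ^ (α - 1) * q⁻¹ * ((α - 1) * (α * φ (Real.log q / 2 - s) + 1 / 2 * φ₁ (Real.log q / 2 - s))
        + 1 / 2 * (α * φ₁ (Real.log q / 2 - s) + 1 / 2 * φ₂ (Real.log q / 2 - s)))) q := by
    intro q hq
    refine ((Real.hasDerivAt_rpow_const (p := α - 1) (Or.inl hq.ne')).fun_mul
      ((((hφ _).comp q (hlog q hq)).const_mul α).add
        (((hφ₁ _).comp q (hlog q hq)).const_mul (1 / 2)))).congr_deriv ?_
    simp only [Function.comp_apply, Pi.add_apply]
    rw [Real.rpow_sub_one hq.ne' (α - 1)]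
    ring
  have hx' : 0 < ‖x‖ := norm_pos_iff.2 hx
  have hlogsq : ∀ y : EuclideanSpace ℝ (Fin n), Real.log (‖y‖ ^ 2) / 2 = Real.log ‖y‖ := fun y => by
    rw [Real.log_pow]; push_cast; ring
  have hpow : ∀ (y : EuclideanSpace ℝ (Fin n)) (β : ℝ), (‖y‖ ^ 2) ^ β = ‖y‖ ^ (2 * β) :=
    fun y β => by
      rw [← Real.rpow_natCast, ← Real.rpow_mul (norm_nonneg y)]; norm_num
  have e1 : (-((n + 2) / 2) - (d - 2) : ℝ) = 2 * α := by rw [hα]; ring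
  have e2 : (-((n + 2) / 2) - d : ℝ) = 2 * (α - 1) := by rw [hα]; ring
  have e3 : ((n - 2) / 2 + d : ℝ) ^ 2 = 4 * α ^ 2 := by rw [hα]; ring
  have e4 : (4 * d + 2 * n : ℝ) = 4 - 8 * α := by rw [hα]; ring
  have h := lap_eval_mul_radial hp hg hg₁ hx
  simp only [hlogsq, hpow] at h
  rw [e1, e2, e3, h, e4]
  have : ‖x‖ ^ 2 * (‖x‖ ^ 2)⁻¹ = 1 := mul_inv_cancel₀ (by positivity)
  linear_combination (4 * eval x.ofLp p * ‖x‖ ^ (2 * (α - 1)) *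
    ((α - 1) * (α * φ (Real.log ‖x‖ - s) + 1 / 2 * φ₁ (Real.log ‖x‖ - s))
        + 1 / 2 * (α * φ₁ (Real.log ‖x‖ - s) + 1 / 2 * φ₂ (Real.log ‖x‖ - s)))) * this

theorem continuousOn_moment_weight {u : EuclideanSpace ℝ (Fin n) → ℝ} (hu : ContinuousOn u {0}ᶜ)
    (p : MvPolynomial (Fin n) ℝ) (a : ℝ) :
    ContinuousOn (fun x : EuclideanSpace ℝ (Fin n) => u x * eval x.ofLp p * ‖x‖ ^ a) {0}ᶜ :=
  (hu.mul (contDiff_eval p (m := 0)).continuous.continuousOn).mul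
    (continuous_norm.continuousOn.rpow_const fun _ hx => Or.inl (norm_ne_zero_iff.2 hx))

theorem hasDerivAt_moment [NeZero n] {u : EuclideanSpace ℝ (Fin n) → ℝ} (hu : ContinuousOn u {0}ᶜ)
    (d : ℝ) (p : MvPolynomial (Fin n) ℝ) {φ : ℝ → ℝ} (hφ : ContDiff ℝ 1 φ)
    (hc : HasCompactSupport φ) (s : ℝ) :
    HasDerivAt (moment u d p φ) (-moment u d p (deriv φ) s) s :=
  hasDerivAt_integral_mul_log_norm (continuousOn_moment_weight hu p _)
    (fun t => (hφ.differentiable (by norm_num) t).hasDerivAt) (hφ.continuous_deriv (by norm_num))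
    hc hc.deriv s

/-- The moments of a solution satisfy ordinary differential equations. -/
theorem moment_deriv_deriv (hn : 3 ≤ n) {γ : ℝ} {u : EuclideanSpace ℝ (Fin n) → ℝ}
    (hu : IsHardySolution n γ u) {d : ℕ} {p : MvPolynomial (Fin n) ℝ} (hp : p.IsHomogeneous d)
    {φ : ℝ → ℝ} (hφ : ContDiff ℝ 2 φ) (hc : HasCompactSupport φ) (s : ℝ) :
    moment u d p (deriv (deriv φ)) s =
      (((n - 2) / 2 + d) ^ 2 - γ) * moment u d p φ s -
        moment u (d - 2) (∑ i, pderiv i (pderiv i p)) φ s := by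
  have : NeZero n := ⟨by omega⟩
  have hn' : (3 : ℝ) ≤ n := by exact_mod_cast hn
  have hφ1 : ContDiff ℝ 1 (deriv φ) := hφ.deriv'
  have hφ2 : Continuous (deriv (deriv φ)) := hφ1.continuous_deriv (by norm_num)
  set Φ : EuclideanSpace ℝ (Fin n) → ℝ := fun y => eval y.ofLp p *
        (‖y‖ ^ (-((n + 2) / 2) - (d - 2) : ℝ) * φ (Real.log ‖y‖ - s)) with hΦ
  obtain ⟨b, hb⟩ := exists_annulus_of_hasCompactSupport (n := n) hc |s|
  have hsupp : Function.support Φ ⊆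
      {x : EuclideanSpace ℝ (Fin n) | exp (-b) ≤ ‖x‖ ∧ ‖x‖ ≤ exp b} := by
    intro x hx
    by_contra hxK
    apply hx
    by_cases hx0 : x = 0
    · have : (-((n + 2) / 2) - (d - 2) : ℝ) ≠ 0 := by
        have : (0 : ℝ) ≤ d := d.cast_nonneg
        intro h; linarith
      simp [hΦ, hx0, Real.zero_rpow this]
    · simp [hΦ, hb s le_rfl x hx0 hxK]
  have hΦc : HasCompactSupport Φ := HasCompactSupport.of_support_subset_isCompact
    (isCompact_annulus b) hsupp
  have hΦ0 : tsupport Φ ⊆ {0}ᶜ :=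
    (closure_minimal hsupp (isCompact_annulus b).isClosed).trans (annulus_subset b)
  have hnorm : ContDiffOn ℝ 2 (fun y : EuclideanSpace ℝ (Fin n) => ‖y‖) {0}ᶜ := fun y hy =>
    (contDiffAt_norm ℝ hy).contDiffWithinAt
  have hΦd : ContDiffOn ℝ 2 Φ {0}ᶜ :=
    (contDiff_eval p).contDiffOn.mul
      ((hnorm.rpow_const_of_ne fun y hy => norm_ne_zero_iff.2 hy).mul
        (hφ.comp_contDiffOn ((hnorm.log fun y hy => norm_ne_zero_iff.2 hy).sub contDiffOn_const)))
  have hgreen := integral_mul_lap_eq hu.contDiffOn hΦd hΦc hΦ0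
  have hI : ∀ (p : MvPolynomial (Fin n) ℝ) (a : ℝ) {ψ : ℝ → ℝ}, Continuous ψ →
      HasCompactSupport ψ → Integrable (fun x : EuclideanSpace ℝ (Fin n) =>
        (u x * eval x.ofLp p * ‖x‖ ^ a) * ψ (Real.log ‖x‖ - s)) := fun p a ψ hψ hψc =>
    integrable_mul_log_norm (continuousOn_moment_weight hu.contDiffOn.continuousOn p a) hψ hψc s
  have hL : ∫ x, u x * lap n Φ x =
      moment u (d - 2) (∑ i, pderiv i (pderiv i p)) φ s +
        (moment u d p (deriv (deriv φ)) s - ((n - 2) / 2 + d) ^ 2 * moment u d p φ s) := by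
    have hI₀ := hI (∑ i, pderiv i (pderiv i p)) (-((n + 2) / 2) - (d - 2)) hφ.continuous hc
    have hI₁ := (hI p (-((n + 2) / 2) - d) hφ.continuous hc).const_mul (((n - 2) / 2 + d) ^ 2)
    have hI₂ := hI p (-((n + 2) / 2) - d) hφ2 hc.deriv.deriv
    have hI₃ := hI₂.sub hI₁
    simp only [Pi.sub_def] at hI₃
    unfold moment
    rw [← integral_const_mul, ← integral_sub hI₂ hI₁, ← integral_add hI₀ hI₃]
    refine integral_congr_ae ?_
    filter_upwards [ae_ne_zero] with x hx
    rw [hΦ, lap_eval_mul_rpow_mul_log hp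
      (fun t => (hφ.differentiable (by norm_num) t).hasDerivAt)
      (fun t => (hφ1.differentiable (by norm_num) t).hasDerivAt) s hx]
    ring
  have hR : ∫ x, lap n u x * Φ x = -γ * moment u d p φ s := by
    unfold moment
    rw [← integral_const_mul]
    refine integral_congr_ae ?_
    filter_upwards [ae_ne_zero] with x hx
    have h1 : lap n u x = -(γ * ‖x‖ ^ (-(2 : ℝ)) * u x) := by
      linarith [hu.eq_zero x hx]
    have h2 : ‖x‖ ^ (-((n + 2) / 2) - d : ℝ) =
        ‖x‖ ^ (-(2 : ℝ)) * ‖x‖ ^ (-((n + 2) / 2) - (d - 2) : ℝ) := by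
      rw [← Real.rpow_add (norm_pos_iff.2 hx)]
      ring_nf
    simp only [hΦ, h1, h2]
    ring
  linarith

end Moments

section MomentRigidity

open MvPolynomial

variable {n : ℕ}

theorem exists_abs_eval_le {d : ℕ} {p : MvPolynomial (Fin n) ℝ} (hp : p.IsHomogeneous d) :
    ∃ M : ℝ, ∀ x : EuclideanSpace ℝ (Fin n), |eval x.ofLp p| ≤ M * ‖x‖ ^ d := by
  refine ⟨∑ m ∈ p.support, |coeff m p|, fun x => ?_⟩
  rw [eval_eq', Finset.sum_mul]
  refine (Finset.abs_sum_le_sum_abs _ _).trans (Finset.sum_le_sum fun m hm => ?_)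
  rw [abs_mul, Finset.abs_prod]
  refine mul_le_mul_of_nonneg_left ?_ (abs_nonneg _)
  have hd : ∑ i, m i = d := by
    rw [← Finsupp.degree_eq_sum]
    exact (Finsupp.degree_eq_weight_one (R := ℕ) ▸ hp (mem_support_iff.1 hm) :)
  rw [← hd, ← Finset.prod_pow_eq_pow_sum]
  refine Finset.prod_le_prod (fun _ _ => abs_nonneg _) fun i _ => ?_
  rw [abs_pow]
  exact pow_le_pow_left₀ (abs_nonneg _) (PiLp.norm_apply_le x i) _

theorem exists_abs_moment_le [NeZero n] {d : ℕ} {p : MvPolynomial (Fin n) ℝ}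
    (hp : p.IsHomogeneous d) :
    ∃ M : ℝ, ∀ u : EuclideanSpace ℝ (Fin n) → ℝ, ContinuousOn u {0}ᶜ → (∀ x ≠ 0, 0 ≤ u x) →
      ∀ φ : ℝ → ℝ, Continuous φ → HasCompactSupport φ → (∀ t, 0 ≤ φ t) → ∀ s,
        |moment u d p φ s| ≤ M * moment u 0 1 φ s := by
  obtain ⟨M, hM⟩ := exists_abs_eval_le hp
  refine ⟨M, fun u hu hu0 φ hφ hc hφ0 s => ?_⟩
  unfold moment
  rw [← integral_const_mul, ← Real.norm_eq_abs]
  refine norm_integral_le_of_norm_le ((integrable_mul_log_norm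
    (continuousOn_moment_weight hu _ _) hφ hc s).const_mul M) ?_
  filter_upwards [ae_ne_zero] with x hx
  have hx' := norm_pos_iff.2 hx
  have h : ‖x‖ ^ (-((n + 2) / 2) - (0 : ℝ) : ℝ) =
      ‖x‖ ^ d * ‖x‖ ^ (-((n + 2) / 2) - (d : ℝ) : ℝ) := by
    rw [← Real.rpow_natCast, ← Real.rpow_add hx']
    ring_nf
  have hpos : 0 ≤ u x * ‖x‖ ^ (-((n + 2) / 2) - (d : ℝ) : ℝ) * φ (Real.log ‖x‖ - s) :=
    mul_nonneg (mul_nonneg (hu0 x hx) (by positivity)) (hφ0 _)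
  calc _ = |eval x.ofLp p| *
        (u x * ‖x‖ ^ (-((n + 2) / 2) - (d : ℝ) : ℝ) * φ (Real.log ‖x‖ - s)) := by
        rw [← abs_of_nonneg hpos, ← abs_mul, Real.norm_eq_abs]
        ring_nf
    _ ≤ M * ‖x‖ ^ d * (u x * ‖x‖ ^ (-((n + 2) / 2) - (d : ℝ) : ℝ) * φ (Real.log ‖x‖ - s)) :=
        mul_le_mul_of_nonneg_right (hM x) hpos
    _ = _ := by
        rw [h]
        simp
        ring

theorem moment_const (u : EuclideanSpace ℝ (Fin n) → ℝ) (d a : ℝ) (φ : ℝ → ℝ) (s : ℝ) :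
    moment u d (C a) φ s = a * moment u d 1 φ s := by
  unfold moment
  rw [← integral_const_mul]
  congr 1
  ext x
  simp
  ring

theorem moment_zero (u : EuclideanSpace ℝ (Fin n) → ℝ) (d : ℝ) (φ : ℝ → ℝ) (s : ℝ) :
    moment u d 0 φ s = 0 := by
  simp [moment]

theorem exists_moment_one_eq (hn : 3 ≤ n) {γ : ℝ} (hγ : γ < ((n : ℝ) - 2) ^ 2 / 4)
    {u : EuclideanSpace ℝ (Fin n) → ℝ} (hu : IsHardySolution n γ u)
    {φ : ℝ → ℝ} (hφ : ContDiff ℝ 2 φ) (hc : HasCompactSupport φ) :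
    ∃ A B : ℝ, ∀ s, moment u 0 1 φ s = A * exp (√(((n : ℝ) - 2) ^ 2 / 4 - γ) * s) +
      B * exp (-(√(((n : ℝ) - 2) ^ 2 / 4 - γ) * s)) := by
  have : NeZero n := ⟨by omega⟩
  have hpos : 0 < ((n : ℝ) - 2) ^ 2 / 4 - γ := by linarith
  refine exists_eq_exp_add_exp (q' := fun s => -moment u 0 1 (deriv φ) s) (Real.sqrt_pos.2 hpos)
    (fun s => hasDerivAt_moment hu.contDiffOn.continuousOn 0 1 (hφ.of_le (by norm_num)) hc s)
    (fun s => ?_)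
  refine (hasDerivAt_moment hu.contDiffOn.continuousOn 0 1 hφ.deriv' hc.deriv s).neg.congr_deriv ?_
  have h := moment_deriv_deriv hn hu (isHomogeneous_one (Fin n) ℝ) hφ hc s
  rw [Real.sq_sqrt hpos.le]
  simp only [pderiv_one, map_zero, Finset.sum_const_zero, moment_zero, Nat.cast_zero] at h
  rw [neg_neg, h]
  ring

/-- The moment of a nonnegative solution against a homogeneous polynomial is a multiple of its
total mass, the factor depending on the polynomial only. -/
theorem exists_moment_eq_mul_moment_one (hn : 3 ≤ n) {γ : ℝ} (hγ : γ < ((n : ℝ) - 2) ^ 2 / 4)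
    (d : ℕ) : ∀ p : MvPolynomial (Fin n) ℝ, p.IsHomogeneous d →
      ∃ c : ℝ, ∀ u : EuclideanSpace ℝ (Fin n) → ℝ, IsHardySolution n γ u →
        ∀ φ : ℝ → ℝ, ContDiff ℝ 2 φ → HasCompactSupport φ → (∀ t, 0 ≤ φ t) → ∀ s,
          moment u d p φ s = c * moment u 0 1 φ s := by
  have : NeZero n := ⟨by omega⟩
  induction d using Nat.strong_induction_on with
  | _ d ih =>
  intro p hp
  rcases Nat.eq_zero_or_pos d with rfl | hd
  · obtain ⟨a, rfl⟩ : ∃ a, p = C a :=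
      ⟨_, totalDegree_eq_zero_iff_eq_C.1 (Nat.le_zero.1 hp.totalDegree_le)⟩
    exact ⟨a, fun u _ φ _ _ _ s => by rw [Nat.cast_zero, moment_const]⟩
  have hlap : (∑ i, pderiv i (pderiv i p)).IsHomogeneous (d - 1 - 1) :=
    IsHomogeneous.sum _ _ _ fun i _ => hp.pderiv.pderiv
  obtain ⟨c₀, hc₀⟩ : ∃ c : ℝ, ∀ u : EuclideanSpace ℝ (Fin n) → ℝ, IsHardySolution n γ u →
      ∀ φ : ℝ → ℝ, ContDiff ℝ 2 φ → HasCompactSupport φ → (∀ t, 0 ≤ φ t) → ∀ s,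
        moment u (d - 2) (∑ i, pderiv i (pderiv i p)) φ s = c * moment u 0 1 φ s := by
    rcases Nat.lt_or_ge d 2 with h2 | h2
    · have h0 : ∑ i, pderiv i (pderiv i p) = 0 := by
        refine Finset.sum_eq_zero fun i _ => ?_
        have h1 : (pderiv i p).IsHomogeneous 0 := by
          have := hp.pderiv (i := i)
          rwa [show d - 1 = 0 by omega] at this
        rw [totalDegree_eq_zero_iff_eq_C.1 (Nat.le_zero.1 h1.totalDegree_le), pderiv_C]
      exact ⟨0, fun u _ φ _ _ _ s => by rw [h0, moment_zero, zero_mul]⟩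
    · obtain ⟨c, hc⟩ := ih (d - 1 - 1) (by omega) _ hlap
      refine ⟨c, fun u hu φ hφ hφc hφ0 s => ?_⟩
      rw [← hc u hu φ hφ hφc hφ0 s]
      congr 1
      rw [Nat.sub_sub, Nat.cast_sub h2]
      norm_num
  obtain ⟨M, hM⟩ := exists_abs_moment_le hp
  have hn' : (3 : ℝ) ≤ n := by exact_mod_cast hn
  have hd' : (1 : ℝ) ≤ d := by exact_mod_cast hd
  set K : ℝ := d * (d + n - 2) with hK
  have hKpos : 0 < K := by rw [hK]; exact mul_pos (by linarith) (by linarith)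
  have hpos : 0 < ((n : ℝ) - 2) ^ 2 / 4 - γ := by linarith
  have hKeq : ((n - 2) / 2 + d : ℝ) ^ 2 - γ = ((n : ℝ) - 2) ^ 2 / 4 - γ + K := by rw [hK]; ring
  refine ⟨c₀ / K, fun u hu φ hφ hφc hφ0 s => ?_⟩
  have hucont := hu.contDiffOn.continuousOn
  obtain ⟨A, B, hAB⟩ := exists_moment_one_eq hn hγ hu hφ hφc
  have hφ1 : ContDiff ℝ 1 φ := hφ.of_le (by norm_num)
  have hφ1' : ContDiff ℝ 1 (deriv φ) := hφ.deriv'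
  obtain ⟨A', B', hAB'⟩ := exists_eq_exp_add_exp
    (q := fun s => moment u d p φ s - c₀ / K * moment u 0 1 φ s)
    (q' := fun s => -moment u d p (deriv φ) s - c₀ / K * -moment u 0 1 (deriv φ) s)
    (κ := √(((n : ℝ) - 2) ^ 2 / 4 - γ + K)) (Real.sqrt_pos.2 (by linarith))
    (fun s => (hasDerivAt_moment hucont _ _ hφ1 hφc s).sub
      ((hasDerivAt_moment hucont _ _ hφ1 hφc s).const_mul _))
    (fun s => by
      refine ((hasDerivAt_moment hucont _ _ hφ1' hφc.deriv s).neg.sub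
        ((hasDerivAt_moment hucont _ _ hφ1' hφc.deriv s).neg.const_mul _)).congr_deriv ?_
      have h1 := moment_deriv_deriv hn hu hp hφ hφc s
      have h0 := moment_deriv_deriv hn hu (isHomogeneous_one (Fin n) ℝ) hφ hφc s
      simp only [pderiv_one, map_zero, Finset.sum_const_zero, moment_zero, Nat.cast_zero] at h0
      rw [hc₀ u hu φ hφ hφc hφ0 s, hKeq] at h1
      rw [neg_neg, neg_neg, h1, h0, Real.sq_sqrt (by linarith)]
      field_simp
      ring)
  obtain ⟨rfl, rfl⟩ := coeff_eq_zero_of_abs_le (A := A') (B := B')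
    (A' := (M + |c₀ / K|) * A) (B' := (M + |c₀ / K|) * B)
    (Real.sqrt_nonneg (((n : ℝ) - 2) ^ 2 / 4 - γ))
    (Real.sqrt_lt_sqrt hpos.le (by linarith : _ < ((n : ℝ) - 2) ^ 2 / 4 - γ + K)) (fun t => by
      rw [← hAB' t]
      have h1 := hM u hucont hu.nonneg φ hφ.continuous hφc hφ0 t
      have h2 : |moment u 0 1 φ t| = moment u 0 1 φ t := abs_of_nonneg <|
        integral_nonneg_of_ae <| by
          filter_upwards [ae_ne_zero] with x hx
          have := hu.nonneg x hx
          have := hφ0 (Real.log ‖x‖ - t)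
          simp only [map_one, mul_one, Pi.zero_apply]
          positivity
      calc _ ≤ |moment u d p φ t| + |c₀ / K * moment u 0 1 φ t| := abs_sub _ _
        _ ≤ (M + |c₀ / K|) * moment u 0 1 φ t := by
          rw [abs_mul, h2]; linarith
        _ = _ := by rw [hAB]; ring)
  have := hAB' s
  simp only [zero_mul, add_zero] at this
  linarith

end MomentRigidity

section Density

open MvPolynomial

variable {n : ℕ}

theorem exists_polynomial_near {K : Set (EuclideanSpace ℝ (Fin n))} (hK : IsCompact K)
    {v : EuclideanSpace ℝ (Fin n) → ℝ} (hv : ContinuousOn v K) {ε : ℝ} (hε : 0 < ε) :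
    ∃ P : MvPolynomial (Fin n) ℝ, ∀ x ∈ K, |eval x.ofLp P - v x| < ε := by
  have : CompactSpace K := isCompact_iff_compactSpace.1 hK
  let coord : Fin n → C(K, ℝ) := fun i =>
    ⟨fun x => x.1 i, (EuclideanSpace.proj (𝕜 := ℝ) (ι := Fin n) i :
      EuclideanSpace ℝ (Fin n) →L[ℝ] ℝ).continuous.comp continuous_subtype_val⟩
  have hcoord : ∀ (P : MvPolynomial (Fin n) ℝ) (x : K), aeval coord P x = eval x.1.ofLp P := by
    intro P x
    induction P using MvPolynomial.induction_on with
    | C a => simp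
    | add p q hp hq => simp [hp, hq]
    | mul_X p i hp =>
      rw [map_mul, aeval_X, map_mul, eval_X, ContinuousMap.mul_apply, hp]
      rfl
  have hsep : (aeval (R := ℝ) coord).range.SeparatesPoints := by
    intro x y hxy
    have : ∃ i, x.1 i ≠ y.1 i := by
      by_contra! h
      exact hxy (Subtype.ext (PiLp.ext h))
    obtain ⟨i, hi⟩ := this
    exact ⟨_, ⟨coord i, ⟨X i, by simp⟩, rfl⟩, hi⟩
  obtain ⟨⟨g, P, rfl⟩, hg⟩ :=
    ContinuousMap.exists_mem_subalgebra_near_continuous_of_separatesPoints _ hsep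
      (K.domRestrict v) hv.domRestrict ε hε
  refine ⟨P, fun x hx => ?_⟩
  have := hg ⟨x, hx⟩
  change ‖aeval coord P ⟨x, hx⟩ - v x‖ < ε at this
  rwa [hcoord, Real.norm_eq_abs] at this

variable [NeZero n]

/-- A continuous function off the origin is determined by its integrals against polynomials times
radial test functions. -/
theorem eq_zero_of_forall_integral_eq_zero {v : EuclideanSpace ℝ (Fin n) → ℝ}
    (hv : ContinuousOn v {0}ᶜ)
    (h : ∀ (d : ℕ) (p : MvPolynomial (Fin n) ℝ), p.IsHomogeneous d → ∀ ψ : ℝ → ℝ, ContDiff ℝ 2 ψ →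
      HasCompactSupport ψ → (∀ t, 0 ≤ ψ t) → ∫ x, v x * eval x.ofLp p * ψ (Real.log ‖x‖) = 0)
    {x₀ : EuclideanSpace ℝ (Fin n)} (hx₀ : x₀ ≠ 0) : v x₀ = 0 := by
  let ψ : ContDiffBump (Real.log ‖x₀‖) := ⟨1, 2, one_pos, one_lt_two⟩
  obtain ⟨b, hb⟩ := exists_annulus_of_hasCompactSupport (n := n) ψ.hasCompactSupport 0
  have hI : ∀ {F : EuclideanSpace ℝ (Fin n) → ℝ}, ContinuousOn F {0}ᶜ →
      Integrable (fun x => F x * ψ (Real.log ‖x‖)) := fun hF => by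
    simpa using integrable_mul_log_norm hF ψ.continuous ψ.hasCompactSupport 0
  have heval : ∀ P : MvPolynomial (Fin n) ℝ,
      ContinuousOn (fun x : EuclideanSpace ℝ (Fin n) => eval x.ofLp P) {0}ᶜ := fun P =>
    (contDiff_eval P (m := 0)).continuous.continuousOn
  have hIP : ∀ P : MvPolynomial (Fin n) ℝ,
      Integrable (fun x => v x * eval x.ofLp P * ψ (Real.log ‖x‖)) := fun P =>
    hI (hv.mul (heval P))
  have hIv : Integrable (fun x => v x * v x * ψ (Real.log ‖x‖)) := hI (hv.mul hv)
  have hpoly : ∀ P : MvPolynomial (Fin n) ℝ,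
      ∫ x, v x * eval x.ofLp P * ψ (Real.log ‖x‖) = 0 := by
    intro P
    have : ∀ x : EuclideanSpace ℝ (Fin n), v x * eval x.ofLp P * ψ (Real.log ‖x‖) =
        ∑ i ∈ Finset.range (P.totalDegree + 1),
          v x * eval x.ofLp (homogeneousComponent i P) * ψ (Real.log ‖x‖) := fun x => by
      rw [← Finset.sum_mul, ← Finset.mul_sum, ← map_sum, sum_homogeneousComponent]
    simp only [this]
    rw [integral_finsetSum _ fun i _ => hIP _]
    exact Finset.sum_eq_zero fun i _ => h i _ (homogeneousComponent_isHomogeneous i P) ψ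
      ψ.contDiff ψ.hasCompactSupport fun t => ψ.nonneg
  have hsq : ∫ x, v x * v x * ψ (Real.log ‖x‖) = 0 := by
    set D := ∫ x, |v x| * ψ (Real.log ‖x‖)
    have hD : 0 ≤ D := integral_nonneg fun x => mul_nonneg (abs_nonneg _) ψ.nonneg
    rw [← abs_nonpos_iff]
    refine le_of_forall_pos_le_add fun δ hδ => ?_
    obtain ⟨P, hP⟩ := exists_polynomial_near (isCompact_annulus b) (hv.mono (annulus_subset b))
      (ε := δ / (D + 1)) (by positivity)
    rw [zero_add, ← sub_zero (∫ x, v x * v x * ψ (Real.log ‖x‖)), ← hpoly P,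
      ← integral_sub hIv (hIP P), ← Real.norm_eq_abs]
    calc _ ≤ ∫ x, δ / (D + 1) * (|v x| * ψ (Real.log ‖x‖)) := by
          refine norm_integral_le_of_norm_le ((hI hv.abs).const_mul _) ?_
          filter_upwards [ae_ne_zero] with x hx
          by_cases hxK : x ∈ {x : EuclideanSpace ℝ (Fin n) | exp (-b) ≤ ‖x‖ ∧ ‖x‖ ≤ exp b}
          · rw [← sub_mul, ← mul_sub, norm_mul, norm_mul, Real.norm_eq_abs, Real.norm_eq_abs,
              Real.norm_eq_abs, abs_of_nonneg (ψ.nonneg : 0 ≤ ψ _), abs_sub_comm]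
            have h1 := mul_le_mul_of_nonneg_left (hP x hxK).le
              (mul_nonneg (abs_nonneg (v x)) (ψ.nonneg : 0 ≤ ψ (Real.log ‖x‖)))
            linarith
          · have := hb 0 (by simp) x hx hxK
            rw [sub_zero] at this
            simp [this]
      _ = δ / (D + 1) * D := integral_const_mul _ _
      _ ≤ δ := by
        rw [div_mul_eq_mul_div, div_le_iff₀ (by positivity)]
        nlinarith
  rw [integral_eq_zero_iff_of_nonneg
    (fun x => mul_nonneg (mul_self_nonneg _) ψ.nonneg) hIv] at hsq
  have := Measure.eqOn_open_of_ae_eq (ae_restrict_of_ae (s := {0}ᶜ) hsq) isOpen_compl_singleton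
    ((hv.mul hv).mul (ψ.continuous.comp_continuousOn continuousOn_log_norm)) continuousOn_const hx₀
  have hψ : ψ (Real.log ‖x₀‖) = 1 :=
    ψ.one_of_mem_closedBall (Metric.mem_closedBall_self ψ.rIn_pos.le)
  simpa [hψ] using this

end Density

section Radial

open MvPolynomial

variable {n : ℕ}

theorem lap_congr {f g : EuclideanSpace ℝ (Fin n) → ℝ} {x : EuclideanSpace ℝ (Fin n)}
    (h : f =ᶠ[𝓝 x] g) : lap n f x = lap n g x := by
  refine Finset.sum_congr rfl fun i _ => ?_
  have : (fun y => fderiv ℝ f y (EuclideanSpace.single i 1)) =ᶠ[𝓝 x]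
      fun y => fderiv ℝ g y (EuclideanSpace.single i 1) := by
    filter_upwards [h.fderiv (𝕜 := ℝ)] with y hy
    rw [hy]
  rw [this.fderiv_eq]

theorem lap_eq_laplacian {f : EuclideanSpace ℝ (Fin n) → ℝ} {x : EuclideanSpace ℝ (Fin n)}
    (hf : ContDiffAt ℝ 2 f x) : lap n f x = Laplacian.laplacian f x := by
  rw [InnerProductSpace.laplacian_eq_iteratedFDeriv_orthonormalBasis f
    (EuclideanSpace.basisFun (Fin n) ℝ)]
  refine Finset.sum_congr rfl fun i _ => ?_
  have hd : DifferentiableAt ℝ (fderiv ℝ f) x :=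
    (hf.fderiv_right (m := 1) (by norm_num)).differentiableAt (by norm_num)
  rw [fderiv_clm_apply hd (differentiableAt_const _), iteratedFDeriv_two_apply]
  simp

theorem lap_comp_linearIsometryEquiv
    (R : EuclideanSpace ℝ (Fin n) ≃ₗᵢ[ℝ] EuclideanSpace ℝ (Fin n))
    {f : EuclideanSpace ℝ (Fin n) → ℝ} {x : EuclideanSpace ℝ (Fin n)}
    (hf : ContDiffAt ℝ 2 f (R x)) : lap n (f ∘ R) x = lap n f (R x) := by
  rw [lap_eq_laplacian hf, lap_eq_laplacian (hf.comp x R.contDiff.contDiffAt),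
    InnerProductSpace.laplacian_eq_iteratedFDeriv_orthonormalBasis (f ∘ R)
      (EuclideanSpace.basisFun (Fin n) ℝ),
    InnerProductSpace.laplacian_eq_iteratedFDeriv_orthonormalBasis f
      ((EuclideanSpace.basisFun (Fin n) ℝ).map R)]
  refine Finset.sum_congr rfl fun i _ => ?_
  have h := R.toContinuousLinearEquiv.iteratedFDerivWithin_comp_right f uniqueDiffOn_univ
    (Set.mem_univ (R x)) 2
  simp only [Set.preimage_univ, iteratedFDerivWithin_univ] at h
  have h' := congrArg (fun T => T ![EuclideanSpace.basisFun (Fin n) ℝ i,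
    EuclideanSpace.basisFun (Fin n) ℝ i]) h
  refine h'.trans ?_
  simp only [ContinuousMultilinearMap.compContinuousLinearMap_apply]
  congr 1
  ext j
  fin_cases j <;> simp

theorem IsHardySolution.comp_linearIsometryEquiv {γ : ℝ} {u : EuclideanSpace ℝ (Fin n) → ℝ}
    (hu : IsHardySolution n γ u)
    (R : EuclideanSpace ℝ (Fin n) ≃ₗᵢ[ℝ] EuclideanSpace ℝ (Fin n)) :
    IsHardySolution n γ (u ∘ R) where
  contDiffOn := hu.contDiffOn.comp R.contDiff.contDiffOn fun x hx => by simpa using hx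
  nonneg x hx := hu.nonneg _ (by simpa using hx)
  eq_zero x hx := by
    have hx' : R x ≠ 0 := by simpa using hx
    rw [lap_comp_linearIsometryEquiv R
      (hu.contDiffOn.contDiffAt (isOpen_compl_singleton.mem_nhds hx'))]
    simpa using hu.eq_zero (R x) hx'

theorem moment_one_comp_linearIsometryEquiv (u : EuclideanSpace ℝ (Fin n) → ℝ)
    (R : EuclideanSpace ℝ (Fin n) ≃ₗᵢ[ℝ] EuclideanSpace ℝ (Fin n)) (d : ℝ) (φ : ℝ → ℝ) (s : ℝ) :
    moment (u ∘ R) d 1 φ s = moment u d 1 φ s := by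
  have := R.measurePreserving.integral_comp R.toMeasurableEquiv.measurableEmbedding
    (fun x => (u x * eval x.ofLp 1 * ‖x‖ ^ (-((n + 2) / 2) - d : ℝ)) * φ (Real.log ‖x‖ - s))
  simpa [moment] using this

/-- Nonnegative solutions of the Hardy equation are radial. -/
theorem IsHardySolution.eq_of_norm_eq (hn : 3 ≤ n) {γ : ℝ} (hγ : γ < ((n : ℝ) - 2) ^ 2 / 4)
    {u : EuclideanSpace ℝ (Fin n) → ℝ} (hu : IsHardySolution n γ u)
    {x y : EuclideanSpace ℝ (Fin n)} (hx : x ≠ 0) (hxy : ‖x‖ = ‖y‖) : u x = u y := by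
  have : NeZero n := ⟨by omega⟩
  obtain ⟨R, hR⟩ : ∃ R : EuclideanSpace ℝ (Fin n) ≃ₗᵢ[ℝ] EuclideanSpace ℝ (Fin n), R x = y :=
    ⟨_, Submodule.reflection_sub hxy⟩
  have huR := hu.comp_linearIsometryEquiv R
  suffices h : u x - (u ∘ R) x = 0 by
    rw [Function.comp_apply, hR] at h
    linarith
  refine eq_zero_of_forall_integral_eq_zero (v := fun x => u x - (u ∘ R) x)
    (hu.contDiffOn.continuousOn.sub huR.contDiffOn.continuousOn) (fun d p hp ψ hψ hψc hψ0 => ?_) hx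
  obtain ⟨c, hc⟩ := exists_moment_eq_mul_moment_one hn hγ d p hp
  set φ : ℝ → ℝ := fun t => exp (((n + 2) / 2 + d) * t) * ψ t with hφ
  have hφd : ContDiff ℝ 2 φ := (contDiff_const.mul contDiff_id).exp.mul hψ
  have hφc : HasCompactSupport φ := hψc.mul_left
  have hφ0 : ∀ t, 0 ≤ φ t := fun t => mul_nonneg (exp_pos _).le (hψ0 t)
  have hmom : ∀ w : EuclideanSpace ℝ (Fin n) → ℝ,
      moment w d p φ 0 = ∫ x, w x * eval x.ofLp p * ψ (Real.log ‖x‖) := by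
    intro w
    refine integral_congr_ae ?_
    filter_upwards [ae_ne_zero] with x hx
    have hx' := norm_pos_iff.2 hx
    have : ‖x‖ ^ (-((n + 2) / 2) - d : ℝ) * exp (((n + 2) / 2 + d) * Real.log ‖x‖) = 1 := by
      rw [Real.rpow_def_of_pos hx', ← exp_add]
      ring_nf
      exact exp_zero
    simp only [hφ, sub_zero]
    linear_combination (w x * eval x.ofLp p * ψ (Real.log ‖x‖)) * this
  have hI : ∀ {w : EuclideanSpace ℝ (Fin n) → ℝ}, ContinuousOn w {0}ᶜ →
      Integrable (fun x => w x * eval x.ofLp p * ψ (Real.log ‖x‖)) := fun hw => by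
    simpa using integrable_mul_log_norm
      (hw.mul (contDiff_eval p (m := 0)).continuous.continuousOn) hψ.continuous hψc 0
  simp only [sub_mul]
  rw [integral_sub (hI hu.contDiffOn.continuousOn) (hI huR.contDiffOn.continuousOn), ← hmom, ← hmom,
    hc u hu φ hφd hφc hφ0, hc _ huR φ hφd hφc hφ0, moment_one_comp_linearIsometryEquiv, sub_self]

/-- A radial solution of the Hardy equation is a combination of the two power solutions. -/
theorem IsHardySolution.exists_eq_rpow_mul (hn : 3 ≤ n) {γ : ℝ} (hγ : γ < ((n : ℝ) - 2) ^ 2 / 4)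
    {u : EuclideanSpace ℝ (Fin n) → ℝ} (hu : IsHardySolution n γ u)
    (hrad : ∀ x y : EuclideanSpace ℝ (Fin n), x ≠ 0 → ‖x‖ = ‖y‖ → u x = u y) :
    ∃ A B : ℝ, 0 ≤ A ∧ 0 ≤ B ∧ ∀ x ≠ 0, u x = ‖x‖ ^ (-((n - 2) / 2) : ℝ) *
      (A * exp (√(((n : ℝ) - 2) ^ 2 / 4 - γ) * Real.log ‖x‖) +
        B * exp (-(√(((n : ℝ) - 2) ^ 2 / 4 - γ) * Real.log ‖x‖))) := by
  have hpos : 0 < ((n : ℝ) - 2) ^ 2 / 4 - γ := by linarith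
  set e : EuclideanSpace ℝ (Fin n) := EuclideanSpace.single ⟨0, by omega⟩ 1 with he
  have he1 : ‖e‖ = 1 := by simp [he]
  have hne : ∀ t : ℝ, exp t • e ≠ 0 := fun t =>
    smul_ne_zero (exp_ne_zero t) (norm_ne_zero_iff.1 (by simp [he1]))
  have hnorm : ∀ t : ℝ, ‖exp t • e‖ = exp t := fun t => by simp [norm_smul, he1]
  set w : ℝ → ℝ := fun t => exp ((n - 2) / 2 * t) * u (exp t • e) with hw
  have hwd : ContDiff ℝ 2 w := by
    refine (contDiff_const.mul contDiff_id).exp.mul ?_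
    exact hu.contDiffOn.comp_contDiff (contDiff_exp.smul contDiff_const) hne
  have hwd1 : ContDiff ℝ 1 (deriv w) := hwd.deriv'
  have huw : ∀ x ≠ 0, u x = ‖x‖ ^ (-((n - 2) / 2) : ℝ) * w (Real.log ‖x‖) := by
    intro x hx
    have hx' := norm_pos_iff.2 hx
    rw [hrad x (exp (Real.log ‖x‖) • e) hx (by rw [hnorm, exp_log hx']), hw,
      Real.rpow_def_of_pos hx', ← mul_assoc, ← exp_add]
    ring_nf
    simp
  have hode : ∀ t, deriv (deriv w) t = (((n : ℝ) - 2) ^ 2 / 4 - γ) * w t := by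
    intro t
    have hx := hne t
    have hu' : u =ᶠ[𝓝 (exp t • e)] fun y => eval y.ofLp (1 : MvPolynomial (Fin n) ℝ) *
        (‖y‖ ^ (-((n + 2) / 2) - ((0 : ℕ) - 2) : ℝ) * w (Real.log ‖y‖ - 0)) := by
      filter_upwards [isOpen_compl_singleton.mem_nhds hx] with y hy
      rw [huw y hy, map_one, one_mul, sub_zero]
      congr 2
      push_cast
      ring
    have hlap := lap_eval_mul_rpow_mul_log (isHomogeneous_one (Fin n) ℝ)
      (fun t => (hwd.differentiable (by norm_num) t).hasDerivAt)
      (fun t => (hwd1.differentiable (by norm_num) t).hasDerivAt) 0 hx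
    rw [← lap_congr hu'] at hlap
    have h := hu.eq_zero _ hx
    rw [hlap, huw _ hx, hnorm, log_exp] at h
    have h1 : exp t ^ (-(2 : ℝ)) * exp t ^ (-((n - 2) / 2) : ℝ) =
        exp t ^ (-((n + 2) / 2) - (0 : ℕ) : ℝ) := by
      rw [← Real.rpow_add (exp_pos t)]
      push_cast
      ring_nf
    simp only [pderiv_one, map_zero, Finset.sum_const_zero, map_one, zero_mul, zero_add, one_mul,
      sub_zero] at h
    have h2 : exp t ^ (-((n + 2) / 2) - (0 : ℕ) : ℝ) *
        (deriv (deriv w) t - (((n : ℝ) - 2) ^ 2 / 4 - γ) * w t) = 0 := by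
      linear_combination h - γ * w t * h1
    have := (mul_eq_zero.1 h2).resolve_left (Real.rpow_pos_of_pos (exp_pos t) _).ne'
    linarith
  obtain ⟨A, B, hAB⟩ := exists_eq_exp_add_exp (Real.sqrt_pos.2 hpos)
    (fun t => (hwd.differentiable (by norm_num) t).hasDerivAt)
    (fun t => by
      rw [Real.sq_sqrt hpos.le, ← hode t]
      exact (hwd1.differentiable (by norm_num) t).hasDerivAt)
  obtain ⟨hA, hB⟩ := coeff_nonneg_of_exp_add_exp_nonneg (Real.sqrt_pos.2 hpos) fun t => by
    rw [← hAB t]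
    exact mul_nonneg (exp_pos _).le (hu.nonneg _ (hne t))
  exact ⟨A, B, hA, hB, fun x hx => by rw [huw x hx, hAB]⟩

end Radial

/-- Liouville-type classification: a nonnegative `C²` solution of
`Δu + γ|x|^{-2}u = 0` on `ℝⁿ\{0}` with `γ < (n−2)²/4` is of the form
`u(x) = C₋|x|^{-β₋(γ)} + C₊|x|^{-β₊(γ)}` with `C₋, C₊ ≥ 0`. -/
theorem stmt_9 (n : ℕ) (hn : 3 ≤ n) (γ : ℝ) (hγ : γ < ((n : ℝ) - 2) ^ 2 / 4)
    (u : EuclideanSpace ℝ (Fin n) → ℝ)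
    (hreg : ContDiffOn ℝ 2 u {(0 : EuclideanSpace ℝ (Fin n))}ᶜ)
    (hnonneg : ∀ x : EuclideanSpace ℝ (Fin n), x ≠ 0 → 0 ≤ u x)
    (heq : ∀ x : EuclideanSpace ℝ (Fin n), x ≠ 0 →
      lap n u x + γ * ‖x‖ ^ (-(2 : ℝ)) * u x = 0) :
    ∃ Cm Cp : ℝ, 0 ≤ Cm ∧ 0 ≤ Cp ∧
      ∀ x : EuclideanSpace ℝ (Fin n), x ≠ 0 →
        u x = Cm * ‖x‖ ^ (-(((n : ℝ) - 2) / 2 - Real.sqrt (((n : ℝ) - 2) ^ 2 / 4 - γ))) +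
              Cp * ‖x‖ ^ (-(((n : ℝ) - 2) / 2 + Real.sqrt (((n : ℝ) - 2) ^ 2 / 4 - γ))) := by
  have hu : IsHardySolution n γ u := ⟨hreg, hnonneg, heq⟩
  obtain ⟨A, B, hA, hB, h⟩ := hu.exists_eq_rpow_mul hn hγ fun x y => hu.eq_of_norm_eq hn hγ
  refine ⟨A, B, hA, hB, fun x hx => ?_⟩
  have hx' := norm_pos_iff.2 hx
  rw [h x hx, Real.rpow_def_of_pos hx', Real.rpow_def_of_pos hx', Real.rpow_def_of_pos hx',
    mul_add, mul_left_comm, mul_left_comm _ B, ← exp_add, ← exp_add]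
  ring_nf
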